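/- Fix an integer k ≥ 1 and write h_r(n) = P(T^{(III)}_{r,k} = n), with the convention h_r(m) = 0 for m < 0. Then for all integers r ≥ 2 and n ≥ 0, h_r(n) = h_r(n−1) − p^k·q·h_r(n−k−1) + p·h_{r−1}(n−1) − p·h_{r−1}(n−2) + p^k·q·h_{r−1}(n−k−1). -/

import Mathlib

open MeasureTheory Finset Classical

/-- `overlapCount k n ω` is `M_{n,k}`: the number of indices `k ≤ i ≤ n` such that
trials `i - k + 1, …, i` are all successes (overlapping counting, trials indexed from `1`). -/
noncomputable def overlapCount (k n : ℕ) (ω : ℕ → Bool) : ℕ :=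
  ((Finset.Icc k n).filter (fun i => ∀ j ∈ Finset.Icc (i - k + 1) i, ω j = true)).card

/-- `T3 k r ω` is `T^{(III)}_{r,k}`: the smallest `n` such that `M_{n,k} = r`. -/
noncomputable def T3 (k r : ℕ) (ω : ℕ → Bool) : ℕ :=
  sInf {n | overlapCount k n ω = r}

/-- The last `k` of the first `n` trials exist and are all successes. -/
def RunAt (k n : ℕ) (ω : ℕ → Bool) : Prop :=
  k ≤ n ∧ ∀ j ∈ Finset.Icc (n - k + 1) n, ω j = true

/-- The event that trial `n` completes the `r`-th overlapping success run of length `k`. -/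
def hitSet (k r n : ℕ) : Set (ℕ → Bool) := {ω | RunAt k n ω ∧ overlapCount k n ω = r}

/-- The event that exactly `r` overlapping runs of length `k` occur in the first `n` trials. -/
def countSet (k r n : ℕ) : Set (ℕ → Bool) := {ω | overlapCount k n ω = r}

/-- Exactly `r` runs in the first `n` trials, then a failure, then `j` successes. -/
def restartSet (k r n j : ℕ) : Set (ℕ → Bool) :=
  {ω | overlapCount k n ω = r ∧ ω (n + 1) = false ∧ ∀ i ∈ Finset.Icc (n + 2) (n + 1 + j), ω i = true}

section Combinatorics

variable {k n m r : ℕ} {ω : ℕ → Bool}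

lemma overlapCount_zero (hk : 1 ≤ k) : overlapCount k 0 ω = 0 := by
  simp [overlapCount, Finset.Icc_eq_empty_of_lt (show 0 < k by omega)]

lemma overlapCount_succ :
    overlapCount k (n + 1) ω = overlapCount k n ω + if RunAt k (n + 1) ω then 1 else 0 := by
  unfold overlapCount
  by_cases hkn : k ≤ n + 1
  · rw [← Finset.insert_Icc_right_eq_Icc_add_one hkn, Finset.filter_insert]
    by_cases h : ∀ j ∈ Finset.Icc (n + 1 - k + 1) (n + 1), ω j = true
    · have hr : RunAt k (n + 1) ω := ⟨hkn, h⟩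
      rw [if_pos h, if_pos hr, Finset.card_insert_of_notMem (by simp)]
    · have hr : ¬ RunAt k (n + 1) ω := fun h' => h h'.2
      rw [if_neg h, if_neg hr, add_zero]
  · have hr : ¬ RunAt k (n + 1) ω := fun h' => hkn h'.1
    rw [if_neg hr, Finset.Icc_eq_empty_of_lt (by omega), Finset.Icc_eq_empty_of_lt (by omega)]
    simp

lemma overlapCount_mono (h : m ≤ n) : overlapCount k m ω ≤ overlapCount k n ω :=
  monotone_nat_of_le_succ (f := fun n => overlapCount k n ω)
    (fun n => by simp only [overlapCount_succ]; omega) h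

lemma overlapCount_of_lt (h : n < k) : overlapCount k n ω = 0 := by
  simp [overlapCount, Finset.Icc_eq_empty_of_lt h]

lemma overlapCount_lt_of_runAt (h : m < n) (hr : RunAt k n ω) :
    overlapCount k m ω < overlapCount k n ω := by
  obtain ⟨n, rfl⟩ : ∃ l, n = l + 1 := ⟨n - 1, by omega⟩
  rw [overlapCount_succ, if_pos hr]
  exact Nat.lt_succ_of_le (overlapCount_mono (by omega))

lemma overlapCount_add_of_false {j : ℕ} (hω : ω (n + 1) = false) (hj : j ≤ k) :
    overlapCount k (n + j) ω = overlapCount k n ω := by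
  induction j with
  | zero => rfl
  | succ j ih =>
    have hr : ¬ RunAt k (n + j + 1) ω := fun h => by
      have := h.2 (n + 1) (by have := h.1; simp; omega)
      simp [hω] at this
    rw [← add_assoc, overlapCount_succ, if_neg hr, ih (by omega), add_zero]

lemma T3_eq_iff (hn : 1 ≤ n) : T3 k r ω = n ↔ ω ∈ hitSet k r n := by
  constructor
  · intro h
    have hne : {n | overlapCount k n ω = r}.Nonempty := by
      by_contra hne
      rw [Set.not_nonempty_iff_eq_empty] at hne
      simp [T3, hne] at h
      omega
    have hmem : overlapCount k n ω = r := h ▸ Nat.sInf_mem hne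
    obtain ⟨n, rfl⟩ : ∃ l, n = l + 1 := ⟨n - 1, by omega⟩
    have hnot : overlapCount k n ω ≠ r :=
      Nat.notMem_of_lt_sInf (s := {n | overlapCount k n ω = r}) (by unfold T3 at h; omega)
    refine ⟨?_, hmem⟩
    by_contra hrun
    rw [overlapCount_succ, if_neg hrun] at hmem
    exact hnot hmem
  · rintro ⟨hrun, hc⟩
    refine le_antisymm (Nat.sInf_le hc) (le_csInf ⟨n, hc⟩ fun m hm => ?_)
    by_contra! hlt
    have := overlapCount_lt_of_runAt hlt hrun
    simp only [Set.mem_ofPred_eq] at hm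
    omega

lemma hitSet_eq_empty_of_lt (h : n < k) : hitSet k r n = ∅ := by
  ext ω
  simp only [hitSet, RunAt, Set.mem_ofPred_eq, Set.mem_empty_iff_false, iff_false]
  omega

lemma hitSet_succ_eq_empty (hr : 2 ≤ r) (h : n < k) : hitSet k r (n + 1) = ∅ := by
  ext ω
  simp only [hitSet, Set.mem_ofPred_eq, Set.mem_empty_iff_false, iff_false, overlapCount_succ,
    overlapCount_of_lt h]
  split_ifs <;> omega

lemma hitSet_disjoint (h : m < n) : Disjoint (hitSet k r m) (hitSet k r n) := by
  rw [Set.disjoint_left]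
  rintro ω ⟨-, h1⟩ ⟨h2, h3⟩
  have := overlapCount_lt_of_runAt h h2
  omega

lemma hitSet_succ_eq (hk : 1 ≤ k) : hitSet k (r + 1) (n + k + 1) =
    (hitSet k r (n + k) ∩ {ω | ω (n + k + 1) = true}) ∪ restartSet k r n k := by
  ext ω
  simp only [hitSet, restartSet, Set.mem_ofPred_eq, Set.mem_union, Set.mem_inter_iff]
  have hrun : RunAt k (n + k + 1) ω ↔ ∀ i ∈ Finset.Icc (n + 2) (n + 1 + k), ω i = true := by
    rw [RunAt, show n + k + 1 - k + 1 = n + 2 by omega, show n + 1 + k = n + k + 1 by omega]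
    exact and_iff_right (by omega)
  have hrun' : RunAt k (n + k) ω ↔ ∀ i ∈ Finset.Icc (n + 1) (n + k), ω i = true := by
    rw [RunAt, show n + k - k + 1 = n + 1 by omega]
    exact and_iff_right (by omega)
  have hstep : RunAt k (n + k + 1) ω → overlapCount k (n + k + 1) ω =
      overlapCount k (n + k) ω + 1 := fun h => by rw [overlapCount_succ, if_pos h]
  constructor
  · rintro ⟨h1, h2⟩
    rw [hstep h1] at h2
    rw [hrun] at h1
    cases hω : ω (n + 1) with
    | true =>
      refine Or.inl ⟨⟨hrun'.2 fun i hi => ?_, by omega⟩, h1 _ (by simp; omega)⟩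
      rcases eq_or_ne i (n + 1) with rfl | hne
      · exact hω
      · exact h1 i (by simp at hi ⊢; omega)
    | false =>
      rw [overlapCount_add_of_false hω le_rfl] at h2
      exact Or.inr ⟨by omega, rfl, h1⟩
  · rintro (⟨⟨h1, h2⟩, h3⟩ | ⟨h1, h2, h3⟩)
    · have : RunAt k (n + k + 1) ω := hrun.2 fun i hi => by
        rcases eq_or_ne i (n + k + 1) with rfl | hne
        · exact h3
        · exact hrun'.1 h1 i (by simp at hi ⊢; omega)
      exact ⟨this, by rw [hstep this, h2]⟩
    · have := hrun.2 h3
      exact ⟨this, by rw [hstep this, overlapCount_add_of_false h2 le_rfl, h1]⟩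

lemma disjoint_hitSet_restartSet (hk : 1 ≤ k) {s : Set (ℕ → Bool)} :
    Disjoint (hitSet k r (n + k) ∩ s) (restartSet k r n k) := by
  rw [Set.disjoint_left]
  rintro ω ⟨⟨h1, -⟩, -⟩ ⟨-, h2, -⟩
  have := h1.2 (n + 1) (by simp; omega)
  simp [h2] at this

lemma restartSet_zero : restartSet k r n 0 = countSet k r n ∩ {ω | ω (n + 1) = false} := by
  ext ω
  simp [restartSet, countSet]

lemma restartSet_succ {j : ℕ} :
    restartSet k r n (j + 1) = restartSet k r n j ∩ {ω | ω (n + 1 + j + 1) = true} := by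
  ext ω
  simp only [restartSet, Set.mem_ofPred_eq, Set.mem_inter_iff, and_assoc, and_congr_right_iff]
  intro _ _
  rw [← add_assoc, ← Finset.insert_Icc_right_eq_Icc_add_one (by omega)]
  simp only [Finset.forall_mem_insert]
  exact and_comm

end Combinatorics

section Dependence

variable {k n m r : ℕ}

lemma dependsOn_overlapCount : DependsOn (overlapCount k n) (Set.Icc 1 n) := by
  intro x y h
  unfold overlapCount
  congr 1
  ext i
  simp only [Finset.mem_filter]
  refine and_congr_right fun hi => forall₂_congr fun j hj => ?_
  rw [h j (by simp at hi hj ⊢; omega)]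

lemma dependsOn_runAt : DependsOn (RunAt k n) (Set.Icc 1 n) := by
  intro x y h
  refine propext (and_congr_right fun _ => forall₂_congr fun j hj => ?_)
  rw [h j (by simp at hj ⊢; omega)]

lemma dependsOn_countSet : DependsOn (· ∈ countSet k r n) (Set.Icc 1 n) := by
  intro x y h
  simp only [countSet, Set.mem_ofPred_eq, dependsOn_overlapCount h]

lemma dependsOn_hitSet : DependsOn (· ∈ hitSet k r n) (Set.Icc 1 n) := by
  intro x y h
  simp only [hitSet, Set.mem_ofPred_eq, dependsOn_overlapCount h, dependsOn_runAt h]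

lemma dependsOn_restartSet {j : ℕ} :
    DependsOn (· ∈ restartSet k r n j) (Set.Icc 1 (n + 1 + j)) := by
  intro x y h
  have hc : overlapCount k n x = overlapCount k n y :=
    dependsOn_overlapCount fun i hi => h i (by simp at hi ⊢; omega)
  have hx : ∀ i ∈ Finset.Icc (n + 2) (n + 1 + j), x i = y i :=
    fun i hi => h i (by simp at hi ⊢; omega)
  simp only [restartSet, Set.mem_ofPred_eq, hc, h (n + 1) (by simp)]
  refine propext (and_congr_right fun _ => and_congr_right fun _ => forall₂_congr fun i hi => ?_)
  rw [hx i hi]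

/-- A set depending on the first `n` trials is a preimage under restriction to these trials. -/
lemma exists_finset_preimage_restrict {A : Set (ℕ → Bool)}
    (hA : DependsOn (· ∈ A) (Set.Icc 1 n)) :
    ∃ S : Finset (Finset.Icc 1 n → Bool), A = (Finset.Icc 1 n).restrict ⁻¹' (S : Set _) := by
  refine ⟨Finset.univ.filter fun c => ∃ ω ∈ A, (Finset.Icc 1 n).restrict ω = c, ?_⟩
  ext ω
  simp only [Set.mem_preimage, Finset.coe_filter, Finset.mem_univ, true_and, Set.mem_ofPred_eq]
  refine ⟨fun h => ⟨ω, h, rfl⟩, ?_⟩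
  rintro ⟨ω', h, he⟩
  have : (ω' ∈ A) = (ω ∈ A) := hA fun i hi => congrFun he ⟨i, by simpa using hi⟩
  exact this ▸ h

lemma measurableSet_of_dependsOn {A : Set (ℕ → Bool)} (hA : DependsOn (· ∈ A) (Set.Icc 1 n)) :
    MeasurableSet A := by
  obtain ⟨S, rfl⟩ := exists_finset_preimage_restrict hA
  exact (Finset.measurable_restrict _) S.measurableSet

end Dependence

/-- `μ` is the law of Bernoulli trials with success probability `p`, indexed from `1`. -/
def IsBernoulliLaw (p : ℝ) (μ : Measure (ℕ → Bool)) : Prop :=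
  ∀ (n : ℕ) (b : ℕ → Bool), μ {ω | ∀ i, 1 ≤ i → i ≤ n → ω i = b i}
    = ENNReal.ofReal (∏ i ∈ Finset.Icc 1 n, if b i = true then p else 1 - p)

section Probability

variable {p : ℝ} {μ : Measure (ℕ → Bool)} {k n r : ℕ}

lemma restrict_preimage_singleton (c : Finset.Icc 1 n → Bool) :
    (Finset.Icc 1 n).restrict (π := fun _ => Bool) ⁻¹' {c} = {ω : ℕ → Bool | ∀ i, 1 ≤ i → i ≤ n →
      ω i = if h : i ∈ Finset.Icc 1 n then c ⟨i, h⟩ else false} := by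
  ext ω
  simp only [Set.mem_preimage, Set.mem_singleton_iff, Set.mem_ofPred_eq, funext_iff,
    Finset.restrict, Subtype.forall]
  refine ⟨fun h i h1 h2 => ?_, fun h i hi => ?_⟩
  · have hi : i ∈ Finset.Icc 1 n := by simp [h1, h2]
    rw [h i hi, dif_pos hi]
  · rw [h i (by simp at hi; omega) (by simp at hi; omega), dif_pos hi]

lemma measure_real_inter_next (hp0 : 0 ≤ p) (hp1 : p ≤ 1) (hμ : IsBernoulliLaw p μ)
    {A : Set (ℕ → Bool)} (hA : DependsOn (· ∈ A) (Set.Icc 1 n)) (b : Bool) :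
    μ.real (A ∩ {ω | ω (n + 1) = b}) = μ.real A * (if b = true then p else 1 - p) := by
  have hw : ∀ c : Bool, 0 ≤ if c = true then p else 1 - p := fun c => by
    split_ifs <;> linarith
  have hB : MeasurableSet {ω : ℕ → Bool | ω (n + 1) = b} :=
    measurableSet_eq_fun (measurable_pi_apply (n + 1)) measurable_const
  have hfib : ∀ c : Finset.Icc 1 n → Bool,
      MeasurableSet ((Finset.Icc 1 n).restrict (π := fun _ => Bool) ⁻¹' {c}) :=
    fun c => (Finset.measurable_restrict _) (measurableSet_singleton c)
  obtain ⟨S, rfl⟩ := exists_finset_preimage_restrict hA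
  have key : μ ((Finset.Icc 1 n).restrict ⁻¹' (S : Set _) ∩ {ω | ω (n + 1) = b}) =
      μ ((Finset.Icc 1 n).restrict ⁻¹' (S : Set _)) *
        ENNReal.ofReal (if b = true then p else 1 - p) := by
    rw [← Measure.restrict_apply' hB,
      ← sum_measure_preimage_singleton (μ := μ) S fun c _ => hfib c,
      ← sum_measure_preimage_singleton (μ := μ.restrict _) S fun c _ => hfib c, Finset.sum_mul]
    refine Finset.sum_congr rfl fun c _ => ?_
    rw [Measure.restrict_apply' hB, restrict_preimage_singleton]
    set e : ℕ → Bool := fun i => if h : i ∈ Finset.Icc 1 n then c ⟨i, h⟩ else false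
    have hset : {ω : ℕ → Bool | ∀ i, 1 ≤ i → i ≤ n → ω i = e i} ∩ {ω | ω (n + 1) = b} =
        {ω | ∀ i, 1 ≤ i → i ≤ n + 1 → ω i = Function.update e (n + 1) b i} := by
      ext ω
      simp only [Set.mem_inter_iff, Set.mem_ofPred_eq]
      refine ⟨fun ⟨h1, h2⟩ i hi hi' => ?_, fun h => ⟨fun i hi hi' => ?_, ?_⟩⟩
      · rcases eq_or_ne i (n + 1) with rfl | hne
        · simpa using h2
        · rw [Function.update_of_ne hne, h1 i hi (by omega)]
      · rw [h i hi (by omega), Function.update_of_ne (by omega)]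
      · simpa using h (n + 1) (by omega) le_rfl
    rw [hset, hμ, hμ, ← ENNReal.ofReal_mul (Finset.prod_nonneg fun i _ => hw (e i)),
      Finset.prod_Icc_succ_top (by omega), Function.update_self]
    congr 2
    refine Finset.prod_congr rfl fun i hi => ?_
    rw [Function.update_of_ne (by simp at hi; omega)]
  rw [measureReal_def, key, ENNReal.toReal_mul, ENNReal.toReal_ofReal (hw b), measureReal_def]

lemma measure_real_restartSet (hp0 : 0 ≤ p) (hp1 : p ≤ 1) (hμ : IsBernoulliLaw p μ) (j : ℕ) :
    μ.real (restartSet k r n j) = p ^ j * (1 - p) * μ.real (countSet k r n) := by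
  induction j with
  | zero =>
    rw [restartSet_zero, measure_real_inter_next hp0 hp1 hμ dependsOn_countSet]
    simp [mul_comm]
  | succ j ih =>
    rw [restartSet_succ, measure_real_inter_next hp0 hp1 hμ dependsOn_restartSet, ih]
    simp only [if_true]
    ring

variable [IsProbabilityMeasure μ]

lemma measure_real_hitSet_succ (hp0 : 0 ≤ p) (hp1 : p ≤ 1) (hμ : IsBernoulliLaw p μ)
    (hk : 1 ≤ k) : μ.real (hitSet k (r + 1) (n + k + 1)) =
      p * μ.real (hitSet k r (n + k)) + p ^ k * (1 - p) * μ.real (countSet k r n) := by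
  rw [hitSet_succ_eq hk, measureReal_union (disjoint_hitSet_restartSet hk)
    (measurableSet_of_dependsOn dependsOn_restartSet), measure_real_restartSet hp0 hp1 hμ,
    measure_real_inter_next hp0 hp1 hμ dependsOn_hitSet]
  simp only [if_true]
  ring

lemma measure_real_countSet_succ : μ.real (countSet k r (n + 1)) + μ.real (hitSet k (r + 1) (n + 1))
    = μ.real (countSet k r n) + μ.real (hitSet k r (n + 1)) := by
  have hD : MeasurableSet {ω | RunAt k (n + 1) ω} :=
    measurableSet_of_dependsOn (n := n + 1) dependsOn_runAt
  have h1 : countSet k r (n + 1) ∩ {ω | RunAt k (n + 1) ω} = hitSet k r (n + 1) := by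
    ext ω
    simp only [countSet, hitSet, Set.mem_inter_iff, Set.mem_ofPred_eq, and_comm]
  have h2 : countSet k r n ∩ {ω | RunAt k (n + 1) ω} = hitSet k (r + 1) (n + 1) := by
    ext ω
    simp only [countSet, hitSet, Set.mem_inter_iff, Set.mem_ofPred_eq, overlapCount_succ]
    by_cases h : RunAt k (n + 1) ω <;> simp [h]
  have h3 : countSet k r (n + 1) \ {ω | RunAt k (n + 1) ω} =
      countSet k r n \ {ω | RunAt k (n + 1) ω} := by
    ext ω
    simp only [countSet, Set.mem_sdiff, Set.mem_ofPred_eq, overlapCount_succ]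
    by_cases h : RunAt k (n + 1) ω <;> simp [h]
  rw [← measureReal_inter_add_sdiff (s := countSet k r (n + 1)) hD,
    ← measureReal_inter_add_sdiff (s := countSet k r n) hD, h1, h2, h3]
  ring

open Filter Topology in
lemma tendsto_measure_real_hitSet :
    Tendsto (fun n => μ.real (hitSet k r n)) atTop (𝓝 0) := by
  have hsum : ∑' n, μ (hitSet k r n) ≠ ⊤ := by
    rw [← measure_iUnion (fun i j hij => ?_) fun n => measurableSet_of_dependsOn dependsOn_hitSet]
    · exact measure_ne_top _ _
    · rcases lt_or_gt_of_ne hij with h | h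
      · exact hitSet_disjoint h
      · exact (hitSet_disjoint h).symm
  exact (ENNReal.tendsto_toReal ENNReal.zero_ne_top).comp
    (ENNReal.tendsto_atTop_zero_of_tsum_ne_top hsum)

open Filter Topology in
lemma tendsto_measure_real_countSet (hp0 : 0 < p) (hp1 : p < 1) (hμ : IsBernoulliLaw p μ)
    (hk : 1 ≤ k) : Tendsto (fun n => μ.real (countSet k r n)) atTop (𝓝 0) := by
  have hc : 0 < p ^ k * (1 - p) := mul_pos (pow_pos hp0 k) (by linarith)
  have hlim := (((tendsto_measure_real_hitSet (μ := μ) (k := k) (r := r + 1)).comp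
    (tendsto_add_atTop_nat (k + 1))).div_const (p ^ k * (1 - p)))
  rw [zero_div] at hlim
  refine squeeze_zero (fun _ => measureReal_nonneg) (fun n => ?_) hlim
  rw [le_div_iff₀ hc, Function.comp_apply, ← add_assoc,
    measure_real_hitSet_succ hp0.le hp1.le hμ hk]
  nlinarith [mul_nonneg hp0.le (measureReal_nonneg (μ := μ) (s := hitSet k r (n + k)))]

open Filter Topology in
lemma measure_real_forall_overlapCount_ne (hp0 : 0 < p) (hp1 : p < 1) (hμ : IsBernoulliLaw p μ)
    (hk : 1 ≤ k) : μ.real {ω | ∀ n, overlapCount k n ω ≠ r} = 0 := by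
  have hlim : Tendsto (fun n => ∑ s ∈ Finset.range r, μ.real (countSet k s n)) atTop (𝓝 0) := by
    simpa using tendsto_finsetSum (Finset.range r)
      fun s _ => tendsto_measure_real_countSet (μ := μ) (r := s) hp0 hp1 hμ hk
  refine le_antisymm (ge_of_tendsto' hlim fun n => ?_) measureReal_nonneg
  refine (measureReal_mono (s₂ := ⋃ s ∈ Finset.range r, countSet k s n) ?_
    (measure_ne_top _ _)).trans
    (measureReal_biUnion_finset_le _ _)
  intro ω hω
  simp only [Set.mem_ofPred_eq] at hω
  have hlt : ∀ n, overlapCount k n ω < r ∨ r = 0 := fun n => by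
    induction n with
    | zero => rw [overlapCount_zero hk]; omega
    | succ n ih =>
      have := hω (n + 1)
      rw [overlapCount_succ] at this ⊢
      split_ifs at this ⊢ <;> omega
  have h0 : r ≠ 0 := fun h => hω 0 (by rw [overlapCount_zero hk, h])
  simp only [Set.mem_iUnion, Finset.mem_range, countSet, Set.mem_ofPred_eq, exists_prop]
  exact ⟨_, (hlt n).resolve_right h0, rfl⟩

lemma measure_real_T3_eq (hp0 : 0 < p) (hp1 : p < 1) (hμ : IsBernoulliLaw p μ)
    (hk : 1 ≤ k) (hr : 1 ≤ r) : μ.real {ω | T3 k r ω = n} = μ.real (hitSet k r n) := by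
  rcases Nat.eq_zero_or_pos n with rfl | hn
  · rw [hitSet_eq_empty_of_lt (by omega), measureReal_empty]
    convert measure_real_forall_overlapCount_ne (r := r) hp0 hp1 hμ hk using 2
    ext ω
    simp only [T3, Set.mem_ofPred_eq, Nat.sInf_eq_zero, overlapCount_zero hk,
      Set.eq_empty_iff_forall_notMem]
    exact or_iff_right (by omega)
  · congr 1
    ext ω
    exact T3_eq_iff hn

end Probability

theorem stmt17 (p : ℝ) (hp0 : 0 < p) (hp1 : p < 1) (k : ℕ) (hk : 1 ≤ k)
    (μ : Measure (ℕ → Bool)) [IsProbabilityMeasure μ]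
    (hμ : ∀ (n : ℕ) (b : ℕ → Bool),
      μ {ω | ∀ i, 1 ≤ i → i ≤ n → ω i = b i}
        = ENNReal.ofReal (∏ i ∈ Finset.Icc 1 n, if b i = true then p else 1 - p))
    -- `H r n = P(T^{(III)}_{r,k} = n)`, extended by `0` to negative indices `n`.
    (H : ℕ → ℤ → ℝ) (hHneg : ∀ (r : ℕ) (n : ℤ), n < 0 → H r n = 0)
    (hHdef : ∀ (r n : ℕ), H r n = (μ {ω | T3 k r ω = n}).toReal) :
    ∀ r : ℕ, 2 ≤ r → ∀ n : ℕ,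
      H r n = H r ((n : ℤ) - 1) - p ^ k * (1 - p) * H r ((n : ℤ) - k - 1)
        + p * H (r - 1) ((n : ℤ) - 1) - p * H (r - 1) ((n : ℤ) - 2)
        + p ^ k * (1 - p) * H (r - 1) ((n : ℤ) - k - 1) := by
  intro r hr n
  obtain ⟨r, rfl⟩ : ∃ s, r = s + 1 := ⟨r - 1, by omega⟩
  rw [Nat.add_sub_cancel]
  have hH : ∀ s m : ℕ, 1 ≤ s → H s m = μ.real (hitSet k s m) := fun s m hs =>
    (hHdef s m).trans (measure_real_T3_eq hp0 hp1 hμ hk hs)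
  have hsmall : ∀ (s : ℕ) (m : ℤ), 1 ≤ s → m < k → H s m = 0 := fun s m hs hm => by
    rcases lt_or_ge m 0 with h | h
    · exact hHneg s m h
    · lift m to ℕ using h
      rw [hH s m hs, hitSet_eq_empty_of_lt (by omega), measureReal_empty]
  have hfirst : ∀ m : ℕ, m ≤ k → H (r + 1) m = 0 := fun m hm => by
    rcases m with _ | m
    · exact hsmall _ _ (by omega) (by omega)
    · rw [hH _ _ (by omega), hitSet_succ_eq_empty hr (by omega), measureReal_empty]
  have hstep : ∀ m : ℕ, H (r + 1) (m + k + 1 : ℕ) =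
      p * H r (m + k : ℕ) + p ^ k * (1 - p) * μ.real (countSet k r m) := fun m => by
    rw [hH _ _ (by omega), hH _ _ (by omega), measure_real_hitSet_succ hp0.le hp1.le hμ hk]
  rcases Nat.lt_or_ge k n with hkn | hkn
  · obtain ⟨m, rfl⟩ : ∃ m, n = m + k + 1 := ⟨n - k - 1, by omega⟩
    rw [show ((m + k + 1 : ℕ) : ℤ) - 1 = (m + k : ℕ) by push_cast; ring,
      show ((m + k + 1 : ℕ) : ℤ) - k - 1 = m by push_cast; ring, hstep m]
    rcases m with _ | m
    · have h0 : μ.real (countSet k r 0) = 0 := by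
        have : countSet k r 0 = ∅ := by
          ext ω
          simp only [countSet, Set.mem_ofPred_eq, overlapCount_zero hk, Set.mem_empty_iff_false,
            iff_false]
          omega
        rw [this, measureReal_empty]
      rw [h0, hfirst (0 + k) (by omega), hsmall (r + 1) _ (by omega) (by omega),
        hsmall r (((0 + k + 1 : ℕ) : ℤ) - 2) (by omega) (by omega),
        hsmall r ((0 : ℕ) : ℤ) (by omega) (by omega)]
      ring
    · have hc := measure_real_countSet_succ (μ := μ) (k := k) (r := r) (n := m)
      rw [← hH _ _ (by omega), ← hH _ _ (by omega)] at hc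
      rw [show ((m + 1 + k + 1 : ℕ) : ℤ) - 2 = (m + k : ℕ) by push_cast; ring,
        show m + 1 + k = m + k + 1 by omega, hstep m]
      linear_combination p ^ k * (1 - p) * hc
  · rw [hfirst n hkn, hsmall (r + 1) ((n : ℤ) - 1) (by omega) (by omega),
      hsmall (r + 1) ((n : ℤ) - k - 1) (by omega) (by omega),
      hsmall r ((n : ℤ) - 1) (by omega) (by omega), hsmall r ((n : ℤ) - 2) (by omega) (by omega),
      hsmall r ((n : ℤ) - k - 1) (by omega) (by omega)]
    ring
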